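/- arXiv:1111.6052 — 6 statements merged into one kernel-verified Lean document; each statement's English description precedes it below -/
import Mathlib

section
/- In the sequential untrusted-device model, assume p_min > 0 and let f : ℝ → ℝ be convex and nondecreasing such that Q_j(a,b | x,y,h) ≤ 2^{−f(I_j(h))} for all j, h, x, y, a, b. Fix real ε, δ > 0, an integer m ≥ 1, and boundary points J_0 ≤ J_1 ≤ ⋯ ≤ J_{m−1} with f(J_0) ≤ 0, and define L(a,b,x,y) ∈ {0,…,m−1} as the largest index ℓ with J_ℓ ≤ Î(a,b,x,y) − ε (and L = 0 if no such ℓ exists). Suppose p ≥ 0 satisfies P[Ī(A,B,X,Y) ≤ Î(A,B,X,Y) − ε] ≤ p. Then there exists a set G of transcripts with P[G] ≥ 1 − m·2^{−δn} − 3p such that for all x ∈ 𝕏^n, y ∈ 𝕐^n and ℓ ∈ {0,…,m−1} with P[X = x, Y = y, L = ℓ, transcript in G] > 0, and for all a ∈ 𝔸^n, b ∈ 𝔹^n, the conditional probability P[A = a, B = b | X = x, Y = y, L = ℓ, transcript in G] is at most 2^{−n·f(J_ℓ) + δ·n + 1}. -/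
open Finset
open scoped Classical

/-- A history of previous rounds: a list of tuples `(a, b, x, y)`. -/
abbrev Hist (𝔸 𝔹 𝕏 𝕐 : Type*) : Type _ := List (𝔸 × 𝔹 × 𝕏 × 𝕐)

/-- A transcript of `n` rounds of interaction: the outputs `a, b` and inputs `x, y`
of all rounds.  The components are `ω.1 = a`, `ω.2.1 = b`, `ω.2.2.1 = x`, `ω.2.2.2 = y`. -/
abbrev Transcript (𝔸 𝔹 𝕏 𝕐 : Type*) (n : ℕ) : Type _ :=
  (Fin n → 𝔸) × (Fin n → 𝔹) × (Fin n → 𝕏) × (Fin n → 𝕐)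

variable {𝔸 𝔹 𝕏 𝕐 : Type*} {n : ℕ}

/-- The data `(a_j, b_j, x_j, y_j)` of round `j` of a transcript (rounds are 0-based). -/
def roundData (ω : Transcript 𝔸 𝔹 𝕏 𝕐 n) (j : Fin n) : 𝔸 × 𝔹 × 𝕏 × 𝕐 :=
  (ω.1 j, ω.2.1 j, ω.2.2.1 j, ω.2.2.2 j)

/-- The history `hist_j` seen before (0-based) round `j`: the data of rounds `0, …, j−1`. -/
def histAt (ω : Transcript 𝔸 𝔹 𝕏 𝕐 n) (j : Fin n) : Hist 𝔸 𝔹 𝕏 𝕐 :=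
  List.ofFn (fun i : Fin j.val => roundData ω (Fin.castLE (le_of_lt j.2) i))

variable [Fintype 𝔸] [Fintype 𝔹] [Fintype 𝕏] [Fintype 𝕐]

/-- The Bell value `I_j(h) = ∑_{a,b,x,y} c(a,b,x,y)·Q_j(a,b|x,y,h)` of round `j`
given the history `h`. -/
noncomputable def roundBell (c : 𝔸 × 𝔹 × 𝕏 × 𝕐 → ℝ)
    (Q : ℕ → 𝔸 → 𝔹 → 𝕏 → 𝕐 → Hist 𝔸 𝔹 𝕏 𝕐 → ℝ) (j : ℕ) (h : Hist 𝔸 𝔹 𝕏 𝕐) : ℝ :=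
  ∑ a : 𝔸, ∑ b : 𝔹, ∑ x : 𝕏, ∑ y : 𝕐, c (a, b, x, y) * Q j a b x y h

/-- The average Bell value `Ī(a,b,x,y) = (1/n)·∑_j I_j(hist_j)` of a transcript. -/
noncomputable def Ibar (c : 𝔸 × 𝔹 × 𝕏 × 𝕐 → ℝ)
    (Q : ℕ → 𝔸 → 𝔹 → 𝕏 → 𝕐 → Hist 𝔸 𝔹 𝕏 𝕐 → ℝ) (ω : Transcript 𝔸 𝔹 𝕏 𝕐 n) : ℝ :=
  (1 / (n : ℝ)) * ∑ j : Fin n, roundBell c Q j (histAt ω j)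

/-- The estimated Bell value `Î(a,b,x,y) = (1/n)·∑_j c(a_j,b_j,x_j,y_j)/P_XY(x_j,y_j)`
of a transcript. -/
noncomputable def Ihat (c : 𝔸 × 𝔹 × 𝕏 × 𝕐 → ℝ) (PXY : 𝕏 × 𝕐 → ℝ)
    (ω : Transcript 𝔸 𝔹 𝕏 𝕐 n) : ℝ :=
  (1 / (n : ℝ)) * ∑ j : Fin n, c (roundData ω j) / PXY (ω.2.2.1 j, ω.2.2.2 j)

/-- The probability mass `P(a,b,x,y) = ∏_j P_XY(x_j,y_j)·Q_j(a_j,b_j|x_j,y_j,hist_j)`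
of a transcript. -/
noncomputable def transcriptProb (PXY : 𝕏 × 𝕐 → ℝ)
    (Q : ℕ → 𝔸 → 𝔹 → 𝕏 → 𝕐 → Hist 𝔸 𝔹 𝕏 𝕐 → ℝ) (ω : Transcript 𝔸 𝔹 𝕏 𝕐 n) : ℝ :=
  ∏ j : Fin n,
    PXY (ω.2.2.1 j, ω.2.2.2 j) * Q j (ω.1 j) (ω.2.1 j) (ω.2.2.1 j) (ω.2.2.2 j) (histAt ω j)

/-- The conditional probability `∏_j Q_j(a_j,b_j|x_j,y_j,hist_j)` of the outputs of
a transcript given its inputs. -/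
noncomputable def outputProb (Q : ℕ → 𝔸 → 𝔹 → 𝕏 → 𝕐 → Hist 𝔸 𝔹 𝕏 𝕐 → ℝ)
    (ω : Transcript 𝔸 𝔹 𝕏 𝕐 n) : ℝ :=
  ∏ j : Fin n, Q j (ω.1 j) (ω.2.1 j) (ω.2.2.1 j) (ω.2.2.2 j) (histAt ω j)

/-- Probability of an event `E` under a probability mass function `P` on a finite type. -/
noncomputable def Pr {Ω : Type*} [Fintype Ω] (P : Ω → ℝ) (E : Set Ω) : ℝ :=
  ∑ ω ∈ Finset.univ.filter (· ∈ E), P ω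

/-- Conditional probability `P[E | F] = P[E ∩ F] / P[F]`. -/
noncomputable def condPr {Ω : Type*} [Fintype Ω] (P : Ω → ℝ) (E F : Set Ω) : ℝ :=
  Pr P (E ∩ F) / Pr P F

/-- The largest index `ℓ ∈ {0,…,m−1}` with `J ℓ ≤ v`, and `0` if no such index exists. -/
noncomputable def largestIdx {m : ℕ} (hm : 0 < m) (J : Fin m → ℝ) (v : ℝ) : Fin m :=
  if h : (Finset.univ.filter fun ℓ : Fin m => J ℓ ≤ v).Nonempty then
    (Finset.univ.filter fun ℓ : Fin m => J ℓ ≤ v).max' h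
  else ⟨0, hm⟩

/-- The path weights of a sequential process whose one-step weights, given the past, sum to one,
sum to one. -/
lemma sum_prod_history_eq_one {D : Type*} [Fintype D] (g : ℕ → List D → D → ℝ) (n : ℕ)
    (hg : ∀ j < n, ∀ h : List D, h.length = j → ∑ d, g j h d = 1) :
    ∑ r : Fin n → D, ∏ j : Fin n,
      g j (List.ofFn fun i : Fin j.val => r (Fin.castLE (le_of_lt j.2) i)) (r j) = 1 := by
  induction n with
  | zero => simp
  | succ n ih =>
    rw [← (Fin.snocEquiv fun _ => D).sum_comp, Fintype.sum_prod_type_right]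
    have key : ∀ (r : Fin n → D) (d : D),
        (∏ j : Fin (n + 1), g j (List.ofFn fun i : Fin j.val =>
          (Fin.snocEquiv fun _ => D) (d, r) (Fin.castLE (le_of_lt j.2) i))
            ((Fin.snocEquiv fun _ => D) (d, r) j)) =
        (∏ j : Fin n,
          g j (List.ofFn fun i : Fin j.val => r (Fin.castLE (le_of_lt j.2) i)) (r j)) *
          g n (List.ofFn r) d := by
      intro r d
      have hsnoc : ∀ (k : ℕ) (hk : k ≤ n) (i : Fin k),
          (Fin.snoc r d : Fin (n + 1) → D) (Fin.castLE (hk.trans n.le_succ) i) =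
            r (Fin.castLE hk i) := fun k hk i =>
        Fin.snoc_castSucc (α := fun _ => D) d r (Fin.castLE hk i)
      rw [Fin.prod_univ_castSucc]
      congr 1
      · refine Finset.prod_congr rfl fun j _ => ?_
        simp only [Fin.snocEquiv_apply, Fin.snoc_castSucc, Fin.val_castSucc]
        congr 2
        funext i
        exact hsnoc _ j.2.le i
      · simp only [Fin.snocEquiv_apply, Fin.snoc_last, Fin.val_last]
        congr 2
        funext i
        exact hsnoc _ le_rfl i
    simp_rw [key, ← Finset.mul_sum]
    rw [← ih fun j hj => hg j (hj.trans n.lt_succ_self)]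
    exact Finset.sum_congr rfl fun r _ => by
      rw [hg n n.lt_succ_self _ List.length_ofFn, mul_one]

/-- A transcript is the same thing as a sequence of round data. -/
def transcriptEquiv (𝔸 𝔹 𝕏 𝕐 : Type*) (n : ℕ) :
    Transcript 𝔸 𝔹 𝕏 𝕐 n ≃ (Fin n → 𝔸 × 𝔹 × 𝕏 × 𝕐) where
  toFun := roundData
  invFun r := (fun j => (r j).1, fun j => (r j).2.1, fun j => (r j).2.2.1, fun j => (r j).2.2.2)
  left_inv _ := rfl
  right_inv _ := rfl

lemma sum_transcriptProb_eq_one (PXY : 𝕏 × 𝕐 → ℝ) (hPXY1 : ∑ xy : 𝕏 × 𝕐, PXY xy = 1)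
    (Q : ℕ → 𝔸 → 𝔹 → 𝕏 → 𝕐 → Hist 𝔸 𝔹 𝕏 𝕐 → ℝ)
    (hQ1 : ∀ j < n, ∀ (x : 𝕏) (y : 𝕐) (h : Hist 𝔸 𝔹 𝕏 𝕐), h.length = j →
      ∑ a : 𝔸, ∑ b : 𝔹, Q j a b x y h = 1) :
    ∑ ω : Transcript 𝔸 𝔹 𝕏 𝕐 n, transcriptProb PXY Q ω = 1 := by
  rw [← sum_prod_history_eq_one (D := 𝔸 × 𝔹 × 𝕏 × 𝕐)
    (fun j h d => PXY (d.2.2.1, d.2.2.2) * Q j d.1 d.2.1 d.2.2.1 d.2.2.2 h) n,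
    ← (transcriptEquiv 𝔸 𝔹 𝕏 𝕐 n).sum_comp]
  · rfl
  · intro j hj h hh
    calc ∑ d : 𝔸 × 𝔹 × 𝕏 × 𝕐, PXY (d.2.2.1, d.2.2.2) * Q j d.1 d.2.1 d.2.2.1 d.2.2.2 h
        = ∑ a : 𝔸, ∑ b : 𝔹, ∑ z : 𝕏 × 𝕐, PXY z * Q j a b z.1 z.2 h := by
          simp_rw [Fintype.sum_prod_type]
      _ = ∑ z : 𝕏 × 𝕐, PXY z * ∑ a : 𝔸, ∑ b : 𝔹, Q j a b z.1 z.2 h := by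
          simp_rw [Finset.mul_sum]
          rw [Finset.sum_comm' (t' := Finset.univ) (s' := fun _ => Finset.univ) (by simp)]
          rw [← Finset.sum_comm]
          simp_rw [fun a => Finset.sum_comm (s := (Finset.univ : Finset 𝔹))
            (t := (Finset.univ : Finset (𝕏 × 𝕐))) (f := fun b z => PXY z * Q j a b z.1 z.2 h)]
          exact Finset.sum_comm
      _ = 1 := by simp_rw [hQ1 j hj _ _ h hh, mul_one, hPXY1]

/-- The probability of the input sequences `x, y`. -/
noncomputable def inputProb (PXY : 𝕏 × 𝕐 → ℝ) (x : Fin n → 𝕏) (y : Fin n → 𝕐) : ℝ :=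
  ∏ j : Fin n, PXY (x j, y j)

lemma sum_inputProb_eq_one (PXY : 𝕏 × 𝕐 → ℝ) (hPXY1 : ∑ xy : 𝕏 × 𝕐, PXY xy = 1) :
    ∑ z : (Fin n → 𝕏) × (Fin n → 𝕐), inputProb PXY z.1 z.2 = 1 := by
  rw [← (Equiv.arrowProdEquivProdArrow (Fin n) (fun _ => 𝕏) (fun _ => 𝕐)).sum_comp]
  rw [← sum_prod_history_eq_one (fun _ _ z => PXY z) n fun _ _ _ _ => hPXY1]
  rfl

lemma outputProb_le_one (Q : ℕ → 𝔸 → 𝔹 → 𝕏 → 𝕐 → Hist 𝔸 𝔹 𝕏 𝕐 → ℝ)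
    (hQ0 : ∀ j a b x y h, 0 ≤ Q j a b x y h)
    (hQ1 : ∀ j < n, ∀ (x : 𝕏) (y : 𝕐) (h : Hist 𝔸 𝔹 𝕏 𝕐), h.length = j →
      ∑ a : 𝔸, ∑ b : 𝔹, Q j a b x y h = 1) (ω : Transcript 𝔸 𝔹 𝕏 𝕐 n) :
    outputProb Q ω ≤ 1 := by
  refine Finset.prod_le_one (fun j _ => hQ0 _ _ _ _ _ _) fun j _ => ?_
  rw [← hQ1 j j.2 (ω.2.2.1 j) (ω.2.2.2 j) (histAt ω j) List.length_ofFn]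
  exact (Finset.single_le_sum (f := fun b => Q j (ω.1 j) b _ _ _)
    (fun b _ => hQ0 _ _ _ _ _ _) (Finset.mem_univ _)).trans
    (Finset.single_le_sum (f := fun a => ∑ b, Q j a b _ _ _)
      (fun a _ => Finset.sum_nonneg fun b _ => hQ0 _ _ _ _ _ _) (Finset.mem_univ (ω.1 j)))

/-- Jensen's inequality turns the one-round guessing bounds into a bound on the whole output
sequence in terms of the average Bell value. -/
lemma outputProb_le_rpow_Ibar (hn : 1 ≤ n) (c : 𝔸 × 𝔹 × 𝕏 × 𝕐 → ℝ)
    (Q : ℕ → 𝔸 → 𝔹 → 𝕏 → 𝕐 → Hist 𝔸 𝔹 𝕏 𝕐 → ℝ)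
    (hQ0 : ∀ j a b x y h, 0 ≤ Q j a b x y h)
    (f : ℝ → ℝ) (hconv : ConvexOn ℝ Set.univ f)
    (hQf : ∀ j < n, ∀ h : Hist 𝔸 𝔹 𝕏 𝕐, h.length = j → ∀ (x : 𝕏) (y : 𝕐) (a : 𝔸) (b : 𝔹),
      Q j a b x y h ≤ (2:ℝ) ^ (-(f (roundBell c Q j h)))) (ω : Transcript 𝔸 𝔹 𝕏 𝕐 n) :
    outputProb Q ω ≤ (2:ℝ) ^ (-((n : ℝ) * f (Ibar c Q ω))) := by
  have hn0 : (0 : ℝ) < n := by exact_mod_cast hn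
  have jensen : f (Ibar c Q ω) ≤
      ∑ j : Fin n, (1 / (n : ℝ)) * f (roundBell c Q j (histAt ω j)) := by
    have := hconv.map_sum_le (t := (Finset.univ : Finset (Fin n))) (w := fun _ => 1 / (n : ℝ))
      (p := fun j => roundBell c Q j (histAt ω j)) (fun _ _ => by positivity)
      (by simp [hn0.ne']) (fun _ _ => Set.mem_univ _)
    simpa only [smul_eq_mul, ← Finset.mul_sum, Ibar] using this
  calc outputProb Q ω ≤ ∏ j : Fin n, (2:ℝ) ^ (-(f (roundBell c Q j (histAt ω j)))) :=
        Finset.prod_le_prod (fun j _ => hQ0 _ _ _ _ _ _)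
          fun j _ => hQf j j.2 _ List.length_ofFn _ _ _ _
    _ = (2:ℝ) ^ (-∑ j : Fin n, f (roundBell c Q j (histAt ω j))) := by
        rw [← Real.rpow_sum_of_pos two_pos, Finset.sum_neg_distrib]
    _ ≤ _ := by
        refine Real.rpow_le_rpow_of_exponent_le one_le_two (neg_le_neg ?_)
        rw [← Finset.mul_sum] at jensen
        calc (n : ℝ) * f (Ibar c Q ω)
            ≤ n * (1 / (n : ℝ) * ∑ j : Fin n, f (roundBell c Q j (histAt ω j))) := by gcongr
          _ = _ := by field_simp

lemma largestIdx_spec {m : ℕ} (hm : 0 < m) (J : Fin m → ℝ) (v : ℝ) :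
    J (largestIdx hm J v) ≤ v ∨ largestIdx hm J v = ⟨0, hm⟩ := by
  unfold largestIdx
  split_ifs with h
  · exact Or.inl (Finset.mem_filter.1 (Finset.max'_mem _ h)).2
  · exact Or.inr rfl

lemma Pr_mono {Ω : Type*} [Fintype Ω] {P : Ω → ℝ} (hP : ∀ ω, 0 ≤ P ω) {E F : Set Ω}
    (h : E ⊆ F) : Pr P E ≤ Pr P F :=
  Finset.sum_le_sum_of_subset_of_nonneg (Finset.monotone_filter_right _ fun _ _ hx => h hx)
    fun ω _ _ => hP ω

lemma nonempty_of_Pr_pos {Ω : Type*} [Fintype Ω] {P : Ω → ℝ} {E : Set Ω} (h : 0 < Pr P E) :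
    E.Nonempty :=
  let ⟨ω, hω, _⟩ := Finset.exists_ne_zero_of_sum_ne_zero h.ne'
  ⟨ω, (Finset.mem_filter.1 hω).2⟩

lemma Pr_le_of_subsingleton {Ω : Type*} [Fintype Ω] {P : Ω → ℝ} {E : Set Ω}
    (hE : E.Subsingleton) {B : ℝ} (hB : 0 ≤ B) (h : ∀ ω ∈ E, P ω ≤ B) : Pr P E ≤ B := by
  rcases hE.eq_empty_or_singleton with rfl | ⟨ω, rfl⟩
  · simpa [Pr] using hB
  · refine le_of_eq_of_le ?_ (h ω rfl)
    refine Finset.sum_eq_single_of_mem ω (by simp) fun ω' hω' hne => ?_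
    exact absurd (Finset.mem_filter.1 hω').2 hne

/-- Discarding from `V` the cells (of a finite partition) whose probability within `V` is below
a threshold costs at most the sum of the thresholds. -/
lemma Pr_sub_sum_le_Pr_heavy {Ω κ : Type*} [Fintype Ω] [Fintype κ] {P : Ω → ℝ} (V : Set Ω)
    (k : Ω → κ) (t : κ → ℝ) (ht : ∀ i, 0 ≤ t i) :
    Pr P V - ∑ i, t i ≤ Pr P {ω | ω ∈ V ∧ t (k ω) ≤ Pr P {ω' | k ω' = k ω ∧ ω' ∈ V}} := by
  have split : Pr P V = Pr P {ω | ω ∈ V ∧ t (k ω) ≤ Pr P {ω' | k ω' = k ω ∧ ω' ∈ V}} +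
      ∑ ω ∈ Finset.univ.filter (fun ω => ω ∈ V ∧ ¬ t (k ω) ≤ Pr P {ω' | k ω' = k ω ∧ ω' ∈ V}),
        P ω := by
    conv_lhs => unfold Pr
    rw [← Finset.sum_filter_add_sum_filter_not (Finset.univ.filter (· ∈ V))
      (fun ω => t (k ω) ≤ Pr P {ω' | k ω' = k ω ∧ ω' ∈ V})]
    rw [Finset.filter_filter, Finset.filter_filter]
    congr 1
    exact Finset.sum_congr (by ext; simp) fun _ _ => rfl
  rw [split, sub_le_iff_le_add, ← Finset.sum_fiberwise _ k]
  gcongr with i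
  by_cases hi : t i ≤ Pr P {ω' | k ω' = i ∧ ω' ∈ V}
  · rw [Finset.sum_eq_zero]
    · exact ht i
    · intro ω hω
      simp only [Finset.mem_filter] at hω
      obtain ⟨⟨_, _, h⟩, rfl⟩ := hω
      exact absurd hi h
  · refine le_trans (le_of_eq ?_) (not_le.1 hi).le
    refine Finset.sum_congr ?_ fun _ _ => rfl
    ext ω
    simp only [Finset.mem_filter, Finset.mem_univ, true_and, Set.mem_ofPred_eq]
    constructor
    · rintro ⟨⟨hV, _⟩, hk⟩
      exact ⟨hk, hV⟩
    · rintro ⟨rfl, hV⟩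
      exact ⟨⟨hV, hi⟩, rfl⟩

/-- **Min-entropy of the outputs of an untrusted device, conditioned on the estimated
Bell value, from an abstract estimation bound.**
In the sequential untrusted-device model with `p_min > 0` and a convex nondecreasing
function `f` with `Q_j(a,b|x,y,h) ≤ 2^{−f(I_j(h))}`, if
`P[Ī ≤ Î − ε] ≤ p`, then there is a "good" event `G` of probability at least
`1 − m·2^{−δn} − 3p` such that conditioned on the inputs `x, y`, on `L = ℓ` (the index
of the interval containing `Î − ε`) and on `G`, every output pair `(a, b)` has
conditional probability at most `2^{−n·f(J_ℓ) + δn + 1}`. -/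
theorem randomness_expansion_min_entropy_of_estimate
    [Nonempty 𝔸] [Nonempty 𝔹] [Nonempty 𝕏] [Nonempty 𝕐]
    (hn : 1 ≤ n)
    (c : 𝔸 × 𝔹 × 𝕏 × 𝕐 → ℝ) (PXY : 𝕏 × 𝕐 → ℝ)
    (hPXY0 : ∀ xy, 0 ≤ PXY xy) (hPXY1 : ∑ xy : 𝕏 × 𝕐, PXY xy = 1)
    (Q : ℕ → 𝔸 → 𝔹 → 𝕏 → 𝕐 → Hist 𝔸 𝔹 𝕏 𝕐 → ℝ)
    (hQ0 : ∀ j a b x y h, 0 ≤ Q j a b x y h)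
    (hQ1 : ∀ j < n, ∀ (x : 𝕏) (y : 𝕐) (h : Hist 𝔸 𝔹 𝕏 𝕐), h.length = j →
      ∑ a : 𝔸, ∑ b : 𝔹, Q j a b x y h = 1)
    (pmin : ℝ) (hpmin : pmin = Finset.univ.inf' Finset.univ_nonempty PXY)
    (hpmin_pos : 0 < pmin)
    (f : ℝ → ℝ) (hconv : ConvexOn ℝ Set.univ f) (hmono : Monotone f)
    (hQf : ∀ j < n, ∀ h : Hist 𝔸 𝔹 𝕏 𝕐, h.length = j → ∀ (x : 𝕏) (y : 𝕐) (a : 𝔸) (b : 𝔹),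
      Q j a b x y h ≤ (2:ℝ) ^ (-(f (roundBell c Q j h))))
    (ε δ : ℝ) (hε : 0 < ε) (hδ : 0 < δ)
    (m : ℕ) (hm : 0 < m)
    (J : Fin m → ℝ) (hJ : Monotone J) (hJ0 : f (J ⟨0, hm⟩) ≤ 0)
    (P : Transcript 𝔸 𝔹 𝕏 𝕐 n → ℝ) (hP : P = transcriptProb PXY Q)
    (L : Transcript 𝔸 𝔹 𝕏 𝕐 n → Fin m)
    (hL : ∀ ω, L ω = largestIdx hm J (Ihat c PXY ω - ε))
    (p : ℝ) (hp : 0 ≤ p)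
    (hest : Pr P {ω | Ibar c Q ω ≤ Ihat c PXY ω - ε} ≤ p) :
    ∃ G : Set (Transcript 𝔸 𝔹 𝕏 𝕐 n),
      1 - (m : ℝ) * (2:ℝ) ^ (-(δ * (n : ℝ))) - 3 * p ≤ Pr P G ∧
      ∀ (x : Fin n → 𝕏) (y : Fin n → 𝕐) (ℓ : Fin m),
        0 < Pr P {ω | ω.2.2.1 = x ∧ ω.2.2.2 = y ∧ L ω = ℓ ∧ ω ∈ G} →
        ∀ (a : Fin n → 𝔸) (b : Fin n → 𝔹),
          condPr P {ω | ω.1 = a ∧ ω.2.1 = b}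
              {ω | ω.2.2.1 = x ∧ ω.2.2.2 = y ∧ L ω = ℓ ∧ ω ∈ G} ≤
            (2:ℝ) ^ (-((n : ℝ) * f (J ℓ)) + δ * (n : ℝ) + 1) := by
  have hn0 : (0 : ℝ) < n := by exact_mod_cast hn
  have hPXY_pos : ∀ xy, 0 < PXY xy := fun xy =>
    hpmin_pos.trans_le (hpmin ▸ Finset.inf'_le _ (Finset.mem_univ xy))
  have hin : ∀ (x : Fin n → 𝕏) (y : Fin n → 𝕐), 0 < inputProb PXY x y := fun x y =>
    Finset.prod_pos fun j _ => hPXY_pos _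
  have hPfac : ∀ ω, P ω = inputProb PXY ω.2.2.1 ω.2.2.2 * outputProb Q ω := fun ω => by
    rw [hP]
    exact Finset.prod_mul_distrib
  have hP0 : ∀ ω, 0 ≤ P ω := fun ω => by
    rw [hPfac]
    exact mul_nonneg (hin _ _).le (Finset.prod_nonneg fun j _ => hQ0 _ _ _ _ _ _)
  set V : Set (Transcript 𝔸 𝔹 𝕏 𝕐 n) := {ω | ¬ Ibar c Q ω ≤ Ihat c PXY ω - ε} with hV
  have hPV : 1 - p ≤ Pr P V := by
    have hsplit := Finset.sum_filter_add_sum_filter_not Finset.univ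
      (fun ω => Ibar c Q ω ≤ Ihat c PXY ω - ε) P
    have htotal : ∑ ω, P ω = 1 := hP ▸ sum_transcriptProb_eq_one PXY hPXY1 Q hQ1
    simp only [Pr, hV, Set.mem_ofPred_eq] at hest ⊢
    linarith
  have hout : ∀ ω ∈ V, outputProb Q ω ≤ (2:ℝ) ^ (-((n : ℝ) * f (J (L ω)))) := by
    intro ω hω
    rcases largestIdx_spec hm J (Ihat c PXY ω - ε) with h | h
    · rw [← hL] at h
      refine (outputProb_le_rpow_Ibar hn c Q hQ0 f hconv hQf ω).trans ?_
      have hf : f (J (L ω)) ≤ f (Ibar c Q ω) := hmono (h.trans (not_le.1 hω).le)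
      refine Real.rpow_le_rpow_of_exponent_le one_le_two ?_
      gcongr
    · rw [← hL] at h
      refine (outputProb_le_one Q hQ0 hQ1 ω).trans (Real.one_le_rpow one_le_two ?_)
      rw [h, neg_nonneg]
      exact mul_nonpos_of_nonneg_of_nonpos hn0.le hJ0
  set t : ℝ := (2:ℝ) ^ (-(δ * (n : ℝ))) with ht
  have ht0 : 0 < t := Real.rpow_pos_of_pos two_pos _
  let cell : Transcript 𝔸 𝔹 𝕏 𝕐 n → ((Fin n → 𝕏) × (Fin n → 𝕐)) × Fin m :=
    fun ω => ((ω.2.2.1, ω.2.2.2), L ω)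
  let thr : ((Fin n → 𝕏) × (Fin n → 𝕐)) × Fin m → ℝ := fun i => inputProb PXY i.1.1 i.1.2 * t
  have hthr : ∑ i, thr i = m * t := by
    rw [Fintype.sum_prod_type]
    simp only [thr, Finset.sum_const, Finset.card_univ, Fintype.card_fin, nsmul_eq_mul]
    rw [← Finset.mul_sum, ← Finset.sum_mul, sum_inputProb_eq_one PXY hPXY1, one_mul]
  refine ⟨{ω | ω ∈ V ∧ thr (cell ω) ≤ Pr P {ω' | cell ω' = cell ω ∧ ω' ∈ V}}, ?_, ?_⟩
  · have := Pr_sub_sum_le_Pr_heavy (P := P) V cell thr fun i => (mul_pos (hin _ _) ht0).le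
    rw [hthr] at this
    linarith
  intro x y ℓ hpos a b
  set F : Set (Transcript 𝔸 𝔹 𝕏 𝕐 n) := {ω | ω.2.2.1 = x ∧ ω.2.2.2 = y ∧ L ω = ℓ ∧
    ω ∈ {ω | ω ∈ V ∧ thr (cell ω) ≤ Pr P {ω' | cell ω' = cell ω ∧ ω' ∈ V}}} with hF
  obtain ⟨ω₀, rfl, rfl, rfl, -, hheavy⟩ := nonempty_of_Pr_pos hpos
  have hden : inputProb PXY ω₀.2.2.1 ω₀.2.2.2 * t ≤ Pr P F := by
    refine hheavy.trans (Pr_mono hP0 ?_)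
    rintro ω ⟨hc, hωV⟩
    have hc' := hc
    simp only [cell, Prod.mk.injEq] at hc'
    refine ⟨hc'.1.1, hc'.1.2, hc'.2, hωV, ?_⟩
    rw [hc]
    exact hheavy
  have hnum : Pr P ({ω | ω.1 = a ∧ ω.2.1 = b} ∩ F) ≤
      inputProb PXY ω₀.2.2.1 ω₀.2.2.2 * (2:ℝ) ^ (-((n : ℝ) * f (J (L ω₀)))) := by
    refine Pr_le_of_subsingleton ?_
      (mul_pos (hin _ _) (Real.rpow_pos_of_pos two_pos _)).le ?_
    · rintro ω ⟨⟨ha, hb⟩, hx, hy, -⟩ ω' ⟨⟨ha', hb'⟩, hx', hy', -⟩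
      exact Prod.ext (ha.trans ha'.symm) (Prod.ext (hb.trans hb'.symm)
        (Prod.ext (hx.trans hx'.symm) (hy.trans hy'.symm)))
    · rintro ω ⟨-, hx, hy, hl, hωV, -⟩
      rw [hPfac, ← hx, ← hy, ← hl]
      exact mul_le_mul_of_nonneg_left (hout ω hωV) (hin _ _).le
  have hx0 := hin ω₀.2.2.1 ω₀.2.2.2
  have hsplit : (2:ℝ) ^ (-((n : ℝ) * f (J (L ω₀)))) =
      (2:ℝ) ^ (-((n : ℝ) * f (J (L ω₀))) + δ * (n : ℝ)) * t := by
    rw [ht, ← Real.rpow_add two_pos]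
    congr 1
    ring
  calc condPr P {ω | ω.1 = a ∧ ω.2.1 = b} F
      ≤ (2:ℝ) ^ (-((n : ℝ) * f (J (L ω₀))) + δ * (n : ℝ)) := by
        rw [condPr, div_le_iff₀ hpos]
        refine hnum.trans ?_
        rw [hsplit, mul_left_comm]
        gcongr
    _ ≤ _ := Real.rpow_le_rpow_of_exponent_le one_le_two (by linarith)
end

section
/- In the sequential untrusted-device model, let f : ℝ → ℝ be convex and suppose that for every round j, every history h, and all a, b, x, y one has Q_j(a,b | x,y,h) ≤ 2^{−f(I_j(h))}. Then for every transcript (a,b,x,y), the conditional probability of the outputs given the inputs satisfies ∏_{j=1}^n Q_j(a_j, b_j | x_j, y_j, hist_j) ≤ 2^{−n·f(Ī(a,b,x,y))}. -/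
open Finset
open scoped Classical

variable {𝔸 𝔹 𝕏 𝕐 : Type*} {n : ℕ}

variable [Fintype 𝔸] [Fintype 𝔹] [Fintype 𝕏] [Fintype 𝕐]

/-- **Pointwise product bound from a convex single-round bound
(equation (A.5) of Pironio et al.).**
If `f` is convex and every single-round conditional distribution satisfies
`Q_j(a,b|x,y,h) ≤ 2^{−f(I_j(h))}`, then for every transcript the conditional probability
of the outputs given the inputs is at most `2^{−n·f(Ī)}` where `Ī` is the average Bell
value of the transcript. -/
theorem outputProb_le_rpow_avg_bell
    [Nonempty 𝔸] [Nonempty 𝔹] [Nonempty 𝕏] [Nonempty 𝕐]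
    (hn : 1 ≤ n)
    (c : 𝔸 × 𝔹 × 𝕏 × 𝕐 → ℝ) (PXY : 𝕏 × 𝕐 → ℝ)
    (hPXY0 : ∀ xy, 0 ≤ PXY xy) (hPXY1 : ∑ xy : 𝕏 × 𝕐, PXY xy = 1)
    (Q : ℕ → 𝔸 → 𝔹 → 𝕏 → 𝕐 → Hist 𝔸 𝔹 𝕏 𝕐 → ℝ)
    (hQ0 : ∀ j a b x y h, 0 ≤ Q j a b x y h)
    (hQ1 : ∀ j < n, ∀ (x : 𝕏) (y : 𝕐) (h : Hist 𝔸 𝔹 𝕏 𝕐), h.length = j →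
      ∑ a : 𝔸, ∑ b : 𝔹, Q j a b x y h = 1)
    (f : ℝ → ℝ) (hconv : ConvexOn ℝ Set.univ f)
    (hQf : ∀ j < n, ∀ h : Hist 𝔸 𝔹 𝕏 𝕐, h.length = j → ∀ (x : 𝕏) (y : 𝕐) (a : 𝔸) (b : 𝔹),
      Q j a b x y h ≤ (2:ℝ) ^ (-(f (roundBell c Q j h)))) :
    ∀ ω : Transcript 𝔸 𝔹 𝕏 𝕐 n,
      outputProb Q ω ≤ (2:ℝ) ^ (-((n : ℝ) * f (Ibar c Q ω))) := by
  intro ω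
  let I : Fin n → ℝ := fun j => roundBell c Q j (histAt ω j)
  have hn0 : (0 : ℝ) < n := by exact_mod_cast hn
  have hprod : outputProb Q ω ≤ ∏ j : Fin n, (2 : ℝ) ^ (-(f (I j))) :=
    prod_le_prod (fun _ _ => hQ0 _ _ _ _ _ _)
      fun j _ => hQf j j.2 (histAt ω j) (by simp [histAt]) _ _ _ _
  have hjensen : f (Ibar c Q ω) ≤ (1 / (n : ℝ)) * ∑ j, f (I j) := by
    have h := hconv.map_sum_le (t := univ) (w := fun _ : Fin n => 1 / (n : ℝ)) (p := I)
      (fun _ _ => by positivity) (by simp [hn0.ne']) (fun _ _ => Set.mem_univ _)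
    simp only [smul_eq_mul, ← mul_sum] at h
    exact h
  have hsum : (n : ℝ) * f (Ibar c Q ω) ≤ ∑ j, f (I j) := by
    calc (n : ℝ) * f (Ibar c Q ω) ≤ n * ((1 / (n : ℝ)) * ∑ j, f (I j)) := by gcongr
      _ = ∑ j, f (I j) := by field_simp
  calc outputProb Q ω ≤ ∏ j : Fin n, (2 : ℝ) ^ (-(f (I j))) := hprod
    _ = (2 : ℝ) ^ (-∑ j, f (I j)) := by
      rw [← sum_neg_distrib, Real.rpow_sum_of_pos two_pos]
    _ ≤ (2 : ℝ) ^ (-((n : ℝ) * f (Ibar c Q ω))) :=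
      Real.rpow_le_rpow_of_exponent_le one_le_two (neg_le_neg hsum)
end

section
/- Let R be a finite type with a probability mass function μ, and let f, g : Bool × R → Bool be arbitrary functions. Let X, Y be independent uniformly distributed random bits, independent of a random variable R distributed according to μ (formally, consider the product distribution of the uniform distribution on Bool × Bool with μ). Then the probability that f(X,R) XOR g(Y,R) equals X AND Y is at most 3/4. -/
open Finset
open scoped Classical

/-- **The classical CHSH bound.**
Two classical parties share a hidden variable `R` distributed according to `μ`; on
independent uniformly random input bits `X`, `Y` (the sample space carries the product
distribution of the uniform distribution on `Bool × Bool` with `μ`), the first party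
outputs `f(X,R)` and the second `g(Y,R)`.  The probability that
`f(X,R) ⊕ g(Y,R) = X ∧ Y` is at most `3/4`. -/
theorem chsh_classical_winning_probability {R : Type*} [Fintype R]
    (μ : R → ℝ) (hμ0 : ∀ r, 0 ≤ μ r) (hμ1 : ∑ r, μ r = 1)
    (f g : Bool × R → Bool) :
    Pr (fun ω : Bool × Bool × R => (1 / 4 : ℝ) * μ ω.2.2)
      {ω : Bool × Bool × R | xor (f (ω.1, ω.2.2)) (g (ω.2.1, ω.2.2)) = (ω.1 && ω.2.1)} ≤
      3 / 4 := by
  have hpoint (r : R) :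
      (∑ x : Bool, ∑ y : Bool,
        if xor (f (x, r)) (g (y, r)) = (x && y) then (1 / 4 : ℝ) * μ r else 0) ≤
        3 / 4 * μ r := by
    have := hμ0 r
    simp only [Fintype.sum_bool]
    cases f (true, r) <;> cases f (false, r) <;> cases g (true, r) <;> cases g (false, r) <;>
      simp <;> linarith
  calc
    _ = ∑ r, ∑ x : Bool, ∑ y : Bool,
        if xor (f (x, r)) (g (y, r)) = (x && y) then (1 / 4 : ℝ) * μ r else 0 := by
      simp only [Pr, Finset.sum_filter, Set.mem_ofPred_eq, Fintype.sum_prod_type,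
        Fintype.sum_bool, Finset.sum_add_distrib]
    _ ≤ ∑ r, 3 / 4 * μ r := Finset.sum_le_sum fun r _ => hpoint r
    _ = 3 / 4 := by rw [← Finset.mul_sum, hμ1, mul_one]
end

section
/- Let R be a finite type with a probability mass function μ, and for each r ∈ R and x ∈ Bool let p(·|x,r) be a probability mass function on Bool, and for each r ∈ R and y ∈ Bool let q(·|y,r) be a probability mass function on Bool. Define the local conditional distribution P(a,b|x,y) = ∑_{r} μ(r)·p(a|x,r)·q(b|y,r). Then the CHSH value I = ∑_{a,b,x,y ∈ Bool} (−1)^{x·y}·(−1)^{a⊕b}·P(a,b|x,y) satisfies |I| ≤ 2, where in the exponents the bits a, b, x, y are identified with elements of {0,1} and x·y denotes the product (i.e., x ∧ y). -/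
open Finset

/-- The CHSH bound for real numbers in `[-1, 1]`. -/
theorem abs_mul_add_add_mul_sub_le_two {a b c d : ℝ}
    (ha : |a| ≤ 1) (hb : |b| ≤ 1) (hc : |c| ≤ 1) (hd : |d| ≤ 1) :
    |a * (c + d) + b * (c - d)| ≤ 2 := by
  have h : |c + d| + |c - d| ≤ 2 := by
    rw [abs_le] at hc hd
    rcases abs_cases (c + d) with h₁ | h₁ <;> rcases abs_cases (c - d) with h₂ | h₂ <;> linarith
  calc |a * (c + d) + b * (c - d)| ≤ |a| * |c + d| + |b| * |c - d| := by
        simpa only [abs_mul] using abs_add_le (a * (c + d)) (b * (c - d))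
    _ ≤ 1 * |c + d| + 1 * |c - d| := by gcongr
    _ ≤ 2 := by linarith

/-- The expectation of a `±1`-valued random bit lies in `[-1, 1]`. -/
theorem abs_sub_le_one_of_sum_bool_eq_one {f : Bool → ℝ} (h₀ : ∀ a, 0 ≤ f a)
    (h₁ : ∑ a, f a = 1) : |f false - f true| ≤ 1 := by
  rw [Fintype.sum_bool] at h₁
  rw [abs_le]
  constructor <;> linarith [h₀ false, h₀ true]

/-- **The CHSH Bell inequality for classical (local) conditional distributions.**
If `P(a,b|x,y) = ∑_r μ(r)·p(a|x,r)·q(b|y,r)` is a local conditional distribution on pairs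
of bits, then its CHSH Bell value `I = ∑_{a,b,x,y} (−1)^{x·y}(−1)^{a⊕b} P(a,b|x,y)`
satisfies `|I| ≤ 2`. -/
theorem chsh_classical_bell_value_le_two {R : Type*} [Fintype R]
    (μ : R → ℝ) (hμ0 : ∀ r, 0 ≤ μ r) (hμ1 : ∑ r, μ r = 1)
    (p : Bool → Bool → R → ℝ)
    (hp0 : ∀ a x r, 0 ≤ p a x r) (hp1 : ∀ x r, ∑ a, p a x r = 1)
    (q : Bool → Bool → R → ℝ)
    (hq0 : ∀ b y r, 0 ≤ q b y r) (hq1 : ∀ y r, ∑ b, q b y r = 1)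
    (P : Bool → Bool → Bool → Bool → ℝ)
    (hP : ∀ a b x y, P a b x y = ∑ r, μ r * p a x r * q b y r) :
    |∑ a : Bool, ∑ b : Bool, ∑ x : Bool, ∑ y : Bool,
        (if x && y then (-1:ℝ) else 1) * (if xor a b then (-1:ℝ) else 1) * P a b x y| ≤ 2 := by
  let A : Bool → R → ℝ := fun x r => p false x r - p true x r
  let B : Bool → R → ℝ := fun y r => q false y r - q true y r
  have hA : ∀ x r, |A x r| ≤ 1 := fun x r =>
    abs_sub_le_one_of_sum_bool_eq_one (fun a => hp0 a x r) (hp1 x r)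
  have hB : ∀ y r, |B y r| ≤ 1 := fun y r =>
    abs_sub_le_one_of_sum_bool_eq_one (fun b => hq0 b y r) (hq1 y r)
  have key : ∑ a : Bool, ∑ b : Bool, ∑ x : Bool, ∑ y : Bool,
      (if x && y then (-1:ℝ) else 1) * (if xor a b then (-1:ℝ) else 1) * P a b x y =
      ∑ r, μ r * (A false r * (B false r + B true r) + A true r * (B false r - B true r)) := by
    simp only [hP, mul_sum, Fintype.sum_bool, ← sum_add_distrib]
    refine sum_congr rfl fun r _ => ?_
    simp [A, B]
    ring
  rw [key]
  calc _ ≤ ∑ r, |μ r * (A false r * (B false r + B true r) +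
        A true r * (B false r - B true r))| := abs_sum_le_sum_abs _ _
    _ ≤ ∑ r, μ r * 2 := by
        refine sum_le_sum fun r _ => ?_
        rw [abs_mul, abs_of_nonneg (hμ0 r)]
        exact mul_le_mul_of_nonneg_left (abs_mul_add_add_mul_sub_le_two
          (hA _ r) (hA _ r) (hB _ r) (hB _ r)) (hμ0 r)
    _ = 2 := by rw [← sum_mul, hμ1, one_mul]
end

section
/- The function f : ℝ → ℝ defined by f(I) = 1 − log₂(1 + √(2 − I²/4)) is convex on the closed interval [2, 2√2]. -/
lemma concaveOn_sqrt_two_sub_sq_div_four :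
    ConcaveOn ℝ (Set.Icc (2:ℝ) (2 * Real.sqrt 2)) (fun I : ℝ => Real.sqrt (2 - I ^ 2 / 4)) := by
  refine ⟨convex_Icc _ _, fun x hx y hy a b ha hb hab => ?_⟩
  have nonneg : ∀ z ∈ Set.Icc (2:ℝ) (2 * Real.sqrt 2), 0 ≤ 2 - z ^ 2 / 4 := fun z hz => by
    nlinarith [hz.1, hz.2, Real.sq_sqrt (show (0:ℝ) ≤ 2 by norm_num)]
  refine (Real.strictConcaveOn_sqrt.concaveOn.2 (nonneg x hx) (nonneg y hy) ha hb hab).trans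
    (Real.sqrt_le_sqrt ?_)
  obtain rfl : b = 1 - a := by linarith
  simp only [smul_eq_mul]
  nlinarith [mul_nonneg (mul_nonneg ha hb) (sq_nonneg (x - y))]

/-- **Convexity of the analytical min-entropy bound of Pironio et al.**
The function `f(I) = 1 − log₂(1 + √(2 − I²/4))` is convex on the interval `[2, 2√2]`. -/
theorem pironio_bound_convexOn :
    ConvexOn ℝ (Set.Icc (2:ℝ) (2 * Real.sqrt 2))
      (fun I : ℝ => 1 - Real.logb 2 (1 + Real.sqrt (2 - I ^ 2 / 4))) := by
  refine ⟨convex_Icc _ _, fun x hx y hy a b ha hb hab => ?_⟩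
  have hsqrt := concaveOn_sqrt_two_sub_sq_div_four.2 hx hy ha hb hab
  have pos : ∀ z : ℝ, 0 < 1 + Real.sqrt (2 - z ^ 2 / 4) := fun z => by positivity
  have hlog := strictConcaveOn_log_Ioi.concaveOn.2 (Set.mem_Ioi.2 (pos x))
    (Set.mem_Ioi.2 (pos y)) ha hb hab
  have hmono : Real.log (a • (1 + Real.sqrt (2 - x ^ 2 / 4)) + b • (1 + Real.sqrt (2 - y ^ 2 / 4)))
      ≤ Real.log (1 + Real.sqrt (2 - (a • x + b • y) ^ 2 / 4)) := by
    refine Real.log_le_log ?_ ?_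
    · exact convex_Ioi (0:ℝ) (pos x) (pos y) ha hb hab
    · simp only [smul_eq_mul] at hsqrt ⊢
      linarith
  have hdiv := div_le_div_of_nonneg_right (hlog.trans hmono) (Real.log_pos one_lt_two).le
  simp only [smul_eq_mul, Real.logb, add_div, mul_div_assoc] at hdiv ⊢
  linarith
end

section
/- Let k and k' be positive integers, let A₀, A₁ ∈ Matrix (Fin k) (Fin k) ℂ and B₀, B₁ ∈ Matrix (Fin k') (Fin k') ℂ be Hermitian matrices with A₀² = A₁² = 1 and B₀² = B₁² = 1 (identity matrices), and let ψ be a unit vector indexed by Fin k × Fin k'. Then |⟨ψ, S ψ⟩| ≤ 2√2, where S = A₀⊗B₀ + A₀⊗B₁ + A₁⊗B₀ − A₁⊗B₁ and ⊗ denotes the Kronecker product. -/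
open Kronecker

/-- The vector form of Tsirelson's bound. -/
theorem norm_inner_chsh_le {E : Type*} [NormedAddCommGroup E] [InnerProductSpace ℂ E]
    {a₀ a₁ b₀ b₁ : E} (ha₀ : ‖a₀‖ = 1) (ha₁ : ‖a₁‖ = 1) (hb₀ : ‖b₀‖ = 1) (hb₁ : ‖b₁‖ = 1) :
    ‖inner ℂ a₀ b₀ + inner ℂ a₀ b₁ + inner ℂ a₁ b₀ - inner ℂ a₁ b₁‖ ≤ 2 * Real.sqrt 2 := by
  have hsum : inner ℂ a₀ b₀ + inner ℂ a₀ b₁ + inner ℂ a₁ b₀ - inner ℂ a₁ b₁ =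
      inner ℂ a₀ (b₀ + b₁) + inner ℂ a₁ (b₀ - b₁) := by
    rw [inner_add_right, inner_sub_right]
    ring
  have h₀ : ‖inner ℂ a₀ (b₀ + b₁)‖ ≤ ‖b₀ + b₁‖ := by
    simpa only [ha₀, one_mul] using norm_inner_le_norm (𝕜 := ℂ) a₀ (b₀ + b₁)
  have h₁ : ‖inner ℂ a₁ (b₀ - b₁)‖ ≤ ‖b₀ - b₁‖ := by
    simpa only [ha₁, one_mul] using norm_inner_le_norm (𝕜 := ℂ) a₁ (b₀ - b₁)
  have hpar := parallelogram_law_with_norm ℂ b₀ b₁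
  rw [hb₀, hb₁] at hpar
  have hle : ‖b₀ + b₁‖ + ‖b₀ - b₁‖ ≤ 2 * Real.sqrt 2 := by
    refine abs_le_of_sq_le_sq' ?_ (by positivity) |>.2
    rw [mul_pow, Real.sq_sqrt zero_le_two]
    nlinarith [sq_nonneg (‖b₀ + b₁‖ - ‖b₀ - b₁‖)]
  rw [hsum]
  exact (norm_add_le _ _).trans ((add_le_add h₀ h₁).trans hle)

/-- A Hermitian matrix can be moved across the standard inner product. -/
theorem Matrix.IsHermitian.inner_toLp_mulVec {n : Type*} [Fintype n] {M : Matrix n n ℂ}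
    (hM : M.IsHermitian) (N : Matrix n n ℂ) (v : n → ℂ) :
    inner ℂ (WithLp.toLp 2 (M.mulVec v)) (WithLp.toLp 2 (N.mulVec v)) =
      star v ⬝ᵥ (M * N).mulVec v := by
  rw [EuclideanSpace.inner_eq_star_dotProduct, dotProduct_comm, Matrix.star_mulVec, hM.eq,
    ← Matrix.dotProduct_mulVec, Matrix.mulVec_mulVec]

/-- A Hermitian involution preserves the Euclidean norm. -/
theorem Matrix.IsHermitian.norm_toLp_mulVec {n : Type*} [Fintype n] [DecidableEq n]
    {M : Matrix n n ℂ} (hM : M.IsHermitian) (hsq : M * M = 1) (v : n → ℂ) :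
    ‖WithLp.toLp 2 (M.mulVec v)‖ = ‖WithLp.toLp 2 v‖ := by
  have h := hM.inner_toLp_mulVec M v
  rw [hsq, Matrix.one_mulVec, dotProduct_comm,
    ← EuclideanSpace.inner_toLp_toLp, inner_self_eq_norm_sq_to_K,
    inner_self_eq_norm_sq_to_K] at h
  exact (sq_eq_sq₀ (norm_nonneg _) (norm_nonneg _)).mp (by exact_mod_cast h)

/-- **Tsirelson's bound.**
For any ±1-valued observables (Hermitian matrices squaring to the identity)
`A₀, A₁` on `ℂ^k` and `B₀, B₁` on `ℂ^{k'}`, and any unit vector `ψ`,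
the CHSH expectation `⟨ψ, (A₀⊗B₀ + A₀⊗B₁ + A₁⊗B₀ − A₁⊗B₁) ψ⟩` has absolute value
at most `2√2`. -/
theorem tsirelson_bound {k k' : ℕ} (hk : 0 < k) (hk' : 0 < k')
    (A₀ A₁ : Matrix (Fin k) (Fin k) ℂ) (B₀ B₁ : Matrix (Fin k') (Fin k') ℂ)
    (hA₀ : A₀.IsHermitian) (hA₁ : A₁.IsHermitian)
    (hB₀ : B₀.IsHermitian) (hB₁ : B₁.IsHermitian)
    (hA₀sq : A₀ * A₀ = 1) (hA₁sq : A₁ * A₁ = 1)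
    (hB₀sq : B₀ * B₀ = 1) (hB₁sq : B₁ * B₁ = 1)
    (ψ : Fin k × Fin k' → ℂ) (hψ : (∑ i : Fin k × Fin k', ‖ψ i‖ ^ 2) = 1) :
    ‖∑ i : Fin k × Fin k', star (ψ i) *
        ((A₀ ⊗ₖ B₀ + A₀ ⊗ₖ B₁ + A₁ ⊗ₖ B₀ - A₁ ⊗ₖ B₁).mulVec ψ i)‖ ≤
      2 * Real.sqrt 2 := by
  have hA {A : Matrix (Fin k) (Fin k) ℂ} (h : A.IsHermitian) :
      (A ⊗ₖ (1 : Matrix (Fin k') (Fin k') ℂ)).IsHermitian := by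
    rw [Matrix.IsHermitian, Matrix.conjTranspose_kronecker, h.eq, Matrix.conjTranspose_one]
  have hB {B : Matrix (Fin k') (Fin k') ℂ} (h : B.IsHermitian) :
      ((1 : Matrix (Fin k) (Fin k) ℂ) ⊗ₖ B).IsHermitian := by
    rw [Matrix.IsHermitian, Matrix.conjTranspose_kronecker, h.eq, Matrix.conjTranspose_one]
  have hψ' : ‖WithLp.toLp 2 ψ‖ = 1 := by
    rw [EuclideanSpace.norm_eq, hψ, Real.sqrt_one]
  have hnA {A : Matrix (Fin k) (Fin k) ℂ} (h : A.IsHermitian) (hsq : A * A = 1) :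
      ‖WithLp.toLp 2 ((A ⊗ₖ (1 : Matrix (Fin k') (Fin k') ℂ)).mulVec ψ)‖ = 1 := by
    rw [(hA h).norm_toLp_mulVec _ ψ, hψ']
    rw [← Matrix.mul_kronecker_mul, hsq, one_mul, Matrix.one_kronecker_one]
  have hnB {B : Matrix (Fin k') (Fin k') ℂ} (h : B.IsHermitian) (hsq : B * B = 1) :
      ‖WithLp.toLp 2 (((1 : Matrix (Fin k) (Fin k) ℂ) ⊗ₖ B).mulVec ψ)‖ = 1 := by
    rw [(hB h).norm_toLp_mulVec _ ψ, hψ']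
    rw [← Matrix.mul_kronecker_mul, hsq, one_mul, Matrix.one_kronecker_one]
  have key := norm_inner_chsh_le (hnA hA₀ hA₀sq) (hnA hA₁ hA₁sq) (hnB hB₀ hB₀sq) (hnB hB₁ hB₁sq)
  simp only [(hA hA₀).inner_toLp_mulVec, (hA hA₁).inner_toLp_mulVec,
    ← Matrix.mul_kronecker_mul, mul_one, one_mul, ← dotProduct_add, ← dotProduct_sub,
    ← Matrix.add_mulVec, ← Matrix.sub_mulVec] at key
  exact key
end
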